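/- Let L ≥ 0, let u be a minimax L-subsolution of (TVP) and let v be a minimax L-supersolution of (TVP). Then u(t,x) ≤ v(t,x) for every (t,x) ∈ [0,T]×Ω. -/

import Mathlib

open MeasureTheory Set Filter Topology
open scoped InnerProductSpace

noncomputable section

namespace PHJ

/-- The Euclidean state space `ℝ^d`. -/
abbrev E (d : ℕ) := EuclideanSpace ℝ (Fin d)

/-- A path; only its values on `[0, T]` are relevant. -/
abbrev Path (d : ℕ) := ℝ → E d

/-- The set `Ω = D([0,T], ℝ^d)` of paths that are right-continuous on `[0,T)` and have
left limits on `(0,T]`. -/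
def Cadlag (T : ℝ) (d : ℕ) : Set (Path d) :=
  {x | (∀ t ∈ Ico (0 : ℝ) T, ContinuousWithinAt x (Ici t) t) ∧
       (∀ t ∈ Ioc (0 : ℝ) T, ∃ l : E d, Tendsto x (nhdsWithin t (Iio t)) (nhds l))}

/-- The running supremum `sup_{0 ≤ s ≤ t} |x(s)|`. -/
def runSup (d : ℕ) (x : Path d) (t : ℝ) : ℝ :=
  sSup ((fun s => ‖x s‖) '' Icc 0 t)

/-- The supremum distance `sup_{0 ≤ s ≤ T} |x(s) − y(s)|`. -/
def supDist (T : ℝ) (d : ℕ) (x y : Path d) : ℝ :=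
  sSup ((fun s => ‖x s - y s‖) '' Icc 0 T)

/-- The stopped supremum distance `sup_{0 ≤ r ≤ T} |x(r ∧ t) − y(r ∧ s)|`. -/
def stopDist (T : ℝ) (d : ℕ) (t : ℝ) (x : Path d) (s : ℝ) (y : Path d) : ℝ :=
  sSup ((fun r => ‖x (min r t) - y (min r s)‖) '' Icc 0 T)

/-- The pseudometric `d_∞` on `[0,T] × Ω`. -/
def dInf (T : ℝ) (d : ℕ) (p q : ℝ × Path d) : ℝ :=
  |p.1 - q.1| + stopDist T d p.1 p.2 q.1 q.2

/-- `g` is an integrable a.e.-derivative of `x` on `[s₀, T]` (so that `x` is absolutely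
continuous there) satisfying the growth bound `|x′(t)| ≤ L (1 + sup_{s ≤ t} |x(s)|)` a.e. -/
def XDeriv (T : ℝ) (d : ℕ) (L s₀ : ℝ) (x g : Path d) : Prop :=
  IntegrableOn g (Icc s₀ T) volume ∧
  (∀ t ∈ Icc s₀ T, x t = x s₀ + ∫ s in s₀..t, g s) ∧
  (∀ᵐ t ∂(volume.restrict (Ioo s₀ T)), ‖g t‖ ≤ L * (1 + runSup d x t))

/-- The set `X^L(s₀, x₀)` of "Lipschitz-like" paths. -/
def XSet (T : ℝ) (d : ℕ) (L s₀ : ℝ) (x₀ : Path d) : Set (Path d) :=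
  {x | x ∈ Cadlag T d ∧ (∀ t ∈ Icc 0 s₀, x t = x₀ t) ∧ ∃ g, XDeriv T d L s₀ x g}

/-- Type of Hamiltonians `H(t, x, y, z)`. -/
abbrev Ham (d : ℕ) := ℝ → Path d → ℝ → E d → ℝ

/-- The set `Y^L(s₀, x₀, y₀, z)` of characteristic pairs `(x, y)`. -/
def YSet (T : ℝ) (d : ℕ) (H : Ham d) (L s₀ : ℝ) (x₀ : Path d) (y₀ : ℝ) (z : E d) :
    Set (Path d × (ℝ → ℝ)) :=
  {p | p.1 ∈ Cadlag T d ∧ (∀ t ∈ Icc 0 s₀, p.1 t = x₀ t) ∧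
       ContinuousOn p.2 (Icc s₀ T) ∧
       ∃ g, XDeriv T d L s₀ p.1 g ∧
         IntegrableOn (fun s => ⟪g s, z⟫_ℝ - H s p.1 (p.2 s) z) (Icc s₀ T) volume ∧
         ∀ t ∈ Icc s₀ T, p.2 t = y₀ + ∫ s in s₀..t, (⟪g s, z⟫_ℝ - H s p.1 (p.2 s) z)}

/-- Assumption (i): for a.e. `t`, `(x, y, z) ↦ H(t, x, y, z)` is continuous. -/
def HamCont (T : ℝ) (d : ℕ) (H : Ham d) : Prop :=
  ∀ᵐ t ∂(volume.restrict (Ioo (0 : ℝ) T)),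
    ∀ x ∈ Cadlag T d, ∀ (y : ℝ) (z : E d), ∀ ε > (0 : ℝ), ∃ δ > (0 : ℝ),
      ∀ x' ∈ Cadlag T d, ∀ (y' : ℝ) (z' : E d),
        supDist T d x x' < δ → |y - y'| < δ → ‖z - z'‖ < δ →
        |H t x y z - H t x' y' z'| < ε

/-- Assumption (ii): `t ↦ H(t, x, y, z)` is Borel measurable. -/
def HamMeas (d : ℕ) (H : Ham d) : Prop :=
  ∀ (x : Path d) (y : ℝ) (z : E d), Measurable fun t => H t x y z

/-- Assumption (iii): Lipschitz continuity in `z` with constant `L_H (1 + sup_{s≤t} |x(s)|)`. -/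
def HamLipZ (T : ℝ) (d : ℕ) (H : Ham d) (LH : ℝ) : Prop :=
  0 ≤ LH ∧ ∀ᵐ t ∂(volume.restrict (Ioo (0 : ℝ) T)),
    ∀ x ∈ Cadlag T d, ∀ (y : ℝ) (z z' : E d),
      |H t x y z - H t x y z'| ≤ LH * (1 + runSup d x t) * ‖z - z'‖

/-- Assumption (iv): local Lipschitz continuity in `x` along `X^L`-paths,
with constant `M L`. -/
def HamLipX (T : ℝ) (d : ℕ) (H : Ham d) (M : ℝ → ℝ) : Prop :=
  ∀ L ≥ (0 : ℝ), 0 ≤ M L ∧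
    ∀ t₀ ∈ Ico (0 : ℝ) T, ∀ x₀ ∈ Cadlag T d,
      ∀ x ∈ XSet T d L t₀ x₀, ∀ x' ∈ XSet T d L t₀ x₀, ∀ (y : ℝ) (z : E d),
        ∀ᵐ t ∂(volume.restrict (Ioo t₀ T)),
          |H t x y z - H t x' y z| ≤
            M L * (1 + |y| + ‖z‖) * sSup ((fun s => ‖x s - x' s‖) '' Icc 0 t)

/-- Assumption (v): `y ↦ H(t, x, y, z)` is non-increasing. -/
def HamMono (T : ℝ) (d : ℕ) (H : Ham d) : Prop :=
  ∀ᵐ t ∂(volume.restrict (Ioo (0 : ℝ) T)),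
    ∀ x ∈ Cadlag T d, ∀ (z : E d) (y y' : ℝ), y ≤ y' → H t x y' z ≤ H t x y z

/-- Assumption (vi): growth bound `|H(t, x, y, 0)| ≤ C_H (1 + sup_{s≤t}|x(s)| + |y|)`. -/
def HamBound (T : ℝ) (d : ℕ) (H : Ham d) (CH : ℝ) : Prop :=
  0 ≤ CH ∧ ∀ᵐ t ∂(volume.restrict (Ioo (0 : ℝ) T)),
    ∀ x ∈ Cadlag T d, ∀ y : ℝ, |H t x y 0| ≤ CH * (1 + runSup d x t + |y|)

/-- Lower semicontinuity on `[0,T] × Ω` with respect to `d_∞`. -/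
def LscOn (T : ℝ) (d : ℕ) (u : ℝ → Path d → ℝ) : Prop :=
  ∀ t₀ ∈ Icc (0 : ℝ) T, ∀ x₀ ∈ Cadlag T d, ∀ c : ℝ, c < u t₀ x₀ →
    ∃ δ > (0 : ℝ), ∀ t ∈ Icc (0 : ℝ) T, ∀ x ∈ Cadlag T d,
      dInf T d (t₀, x₀) (t, x) < δ → c < u t x

/-- Upper semicontinuity on `[0,T] × Ω` with respect to `d_∞`. -/
def UscOn (T : ℝ) (d : ℕ) (u : ℝ → Path d → ℝ) : Prop :=
  ∀ t₀ ∈ Icc (0 : ℝ) T, ∀ x₀ ∈ Cadlag T d, ∀ c : ℝ, u t₀ x₀ < c →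
    ∃ δ > (0 : ℝ), ∀ t ∈ Icc (0 : ℝ) T, ∀ x ∈ Cadlag T d,
      dInf T d (t₀, x₀) (t, x) < δ → u t x < c

/-- Continuity of the terminal condition `h` with respect to the sup norm. -/
def TermCont (T : ℝ) (d : ℕ) (h : Path d → ℝ) : Prop :=
  ∀ x ∈ Cadlag T d, ∀ ε > (0 : ℝ), ∃ δ > (0 : ℝ), ∀ x' ∈ Cadlag T d,
    supDist T d x x' < δ → |h x' - h x| < ε

/-- `u` is a minimax `L`-supersolution of the terminal-value problem (TVP). -/
def MinimaxSuper (T : ℝ) (d : ℕ) (H : Ham d) (h : Path d → ℝ) (L : ℝ)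
    (u : ℝ → Path d → ℝ) : Prop :=
  LscOn T d u ∧ (∀ x ∈ Cadlag T d, h x ≤ u T x) ∧
  ∀ s₀ ∈ Ico (0 : ℝ) T, ∀ x₀ ∈ Cadlag T d, ∀ (z : E d) (y₀ : ℝ), u s₀ x₀ ≤ y₀ →
    ∃ p ∈ YSet T d H L s₀ x₀ y₀ z, ∀ t ∈ Icc s₀ T, u t p.1 ≤ p.2 t

/-- `u` is a minimax `L`-subsolution of the terminal-value problem (TVP). -/
def MinimaxSub (T : ℝ) (d : ℕ) (H : Ham d) (h : Path d → ℝ) (L : ℝ)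
    (u : ℝ → Path d → ℝ) : Prop :=
  UscOn T d u ∧ (∀ x ∈ Cadlag T d, u T x ≤ h x) ∧
  ∀ s₀ ∈ Ico (0 : ℝ) T, ∀ x₀ ∈ Cadlag T d, ∀ (z : E d) (y₀ : ℝ), y₀ ≤ u s₀ x₀ →
    ∃ p ∈ YSet T d H L s₀ x₀ y₀ z, ∀ t ∈ Icc s₀ T, p.2 t ≤ u t p.1

/-- `u` is a minimax `L`-solution of the terminal-value problem (TVP). -/
def MinimaxSol (T : ℝ) (d : ℕ) (H : Ham d) (h : Path d → ℝ) (L : ℝ)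
    (u : ℝ → Path d → ℝ) : Prop :=
  MinimaxSuper T d H h L u ∧ MinimaxSub T d H h L u

/-- Embedding of a path into the space of functions on `[0,T]` with the topology of
uniform convergence (i.e. the sup-norm topology). -/
def toUnif (T : ℝ) (d : ℕ) (x : Path d) : UniformFun (Icc (0 : ℝ) T) (E d) :=
  UniformFun.ofFun fun s => x s.1

/-- Embedding of a real-valued function into the space of functions on `[s₀,T]` with the
topology of uniform convergence. -/
def toUnifR (T s₀ : ℝ) (y : ℝ → ℝ) : UniformFun (Icc s₀ T) ℝ :=
  UniformFun.ofFun fun s => y s.1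


/-- Continuity on `[0,T] × Ω` with respect to `d_∞`. -/
def Cont2 (T : ℝ) (d : ℕ) (u : ℝ → Path d → ℝ) : Prop :=
  ∀ t₀ ∈ Icc (0 : ℝ) T, ∀ x₀ ∈ Cadlag T d, ∀ ε > (0 : ℝ), ∃ δ > (0 : ℝ),
    ∀ t ∈ Icc (0 : ℝ) T, ∀ x ∈ Cadlag T d,
      dInf T d (t₀, x₀) (t, x) < δ → |u t x - u t₀ x₀| < ε

section Paths

variable {T : ℝ} {d : ℕ}

theorem bddAbove_norm_of_mem_cadlag {x : Path d} (hx : x ∈ Cadlag T d) :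
    BddAbove ((fun s => ‖x s‖) '' Icc 0 T) := by
  refine isCompact_Icc.induction_on (p := fun s => BddAbove ((fun r => ‖x r‖) '' s))
    (by simp) (fun s t hst ht => ht.mono (image_mono hst))
    (fun s t hs ht => by rw [image_union]; exact hs.union ht) fun t ht => ?_
  have hleft : ∃ C, ∀ᶠ s in 𝓝 t, s ∈ Icc 0 T → s < t → ‖x s‖ ≤ C := by
    rcases ht.1.eq_or_lt with rfl | h0
    · exact ⟨0, Eventually.of_forall fun s hs hs' => absurd hs.1 (not_le.2 hs')⟩
    · obtain ⟨l, hl⟩ := hx.2 t ⟨h0, ht.2⟩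
      refine ⟨‖l‖ + 1, ?_⟩
      have := hl.norm.eventually (eventually_le_nhds (lt_add_one ‖l‖))
      filter_upwards [eventually_nhdsWithin_iff.1 this] with s hs _ hst using hs hst
  have hright : ∃ C, ∀ᶠ s in 𝓝 t, s ∈ Icc 0 T → t ≤ s → ‖x s‖ ≤ C := by
    rcases ht.2.eq_or_lt with rfl | h0
    · refine ⟨‖x t‖, Eventually.of_forall fun s hs hs' => ?_⟩
      rw [le_antisymm hs.2 hs']
    · refine ⟨‖x t‖ + 1, ?_⟩
      have := (hx.1 t ⟨ht.1, h0⟩).norm.eventually (eventually_le_nhds (lt_add_one ‖x t‖))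
      filter_upwards [eventually_nhdsWithin_iff.1 this] with s hs _ hst using hs hst
  obtain ⟨C₁, h₁⟩ := hleft
  obtain ⟨C₂, h₂⟩ := hright
  refine ⟨{s | ‖x s‖ ≤ max C₁ C₂}, ?_, max C₁ C₂, by rintro _ ⟨s, hs, rfl⟩; exact hs⟩
  refine mem_nhdsWithin_iff_eventually.2 ?_
  filter_upwards [h₁, h₂] with s hs₁ hs₂ hs
  rcases lt_or_ge s t with h | h
  · exact (hs₁ hs h).trans (le_max_left _ _)
  · exact (hs₂ hs h).trans (le_max_right _ _)

theorem sub_mem_cadlag {x y : Path d} (hx : x ∈ Cadlag T d) (hy : y ∈ Cadlag T d) :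
    (fun s => x s - y s) ∈ Cadlag T d := by
  refine ⟨fun t ht => (hx.1 t ht).sub (hy.1 t ht), fun t ht => ?_⟩
  obtain ⟨l, hl⟩ := hx.2 t ht
  obtain ⟨m, hm⟩ := hy.2 t ht
  exact ⟨l - m, hl.sub hm⟩

theorem norm_le_runSup {x : Path d} (hx : x ∈ Cadlag T d) {s t : ℝ} (hs : s ∈ Icc 0 t)
    (ht : t ≤ T) : ‖x s‖ ≤ runSup d x t :=
  le_csSup ((bddAbove_norm_of_mem_cadlag hx).mono (image_mono (Icc_subset_Icc_right ht)))
    (mem_image_of_mem (fun s => ‖x s‖) hs)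

theorem runSup_le {x : Path d} {t c : ℝ} (hc : 0 ≤ c) (h : ∀ s ∈ Icc 0 t, ‖x s‖ ≤ c) :
    runSup d x t ≤ c :=
  Real.sSup_le (by rintro _ ⟨s, hs, rfl⟩; exact h s hs) hc

theorem runSup_nonneg (x : Path d) (t : ℝ) : 0 ≤ runSup d x t :=
  Real.sSup_nonneg (by rintro _ ⟨s, -, rfl⟩; exact norm_nonneg _)

theorem runSup_mono {x : Path d} (hx : x ∈ Cadlag T d) {s t : ℝ} (hst : s ≤ t) (ht : t ≤ T) :
    runSup d x s ≤ runSup d x t :=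
  runSup_le (runSup_nonneg _ _) fun _ hr => norm_le_runSup hx ⟨hr.1, hr.2.trans hst⟩ ht

theorem runSup_congr {x y : Path d} {t : ℝ} (h : ∀ s ∈ Icc 0 t, x s = y s) :
    runSup d x t = runSup d y t := by
  unfold runSup
  rw [image_congr fun s hs => by rw [h s hs]]

/-- Restarting an `XSet` path at a later time `a` stays in the same `XSet`. -/
theorem mem_XSet_trans {L t₀ a : ℝ} {x₀ x x' : Path d} (ht₀ : 0 ≤ t₀) (ha : a ∈ Icc t₀ T)
    (hx : x ∈ XSet T d L t₀ x₀) (hx' : x' ∈ XSet T d L a x) : x' ∈ XSet T d L t₀ x₀ := by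
  obtain ⟨-, hx₀, g, hg, hgx, hgL⟩ := hx
  obtain ⟨hc, hxx, g', hg', hgx', hgL'⟩ := hx'
  have hint : IntegrableOn (fun s => if s ≤ a then g s else g' s) (Icc t₀ T) := by
    rw [← Icc_union_Ioc_eq_Icc ha.1 ha.2]
    refine IntegrableOn.union ?_ ?_
    · refine (hg.mono_set (Icc_subset_Icc_right ha.2)).congr_fun (fun s hs => ?_)
        measurableSet_Icc
      simp [hs.2]
    · refine (hg'.mono_set Ioc_subset_Icc_self).congr_fun (fun s hs => ?_) measurableSet_Ioc
      simp [hs.1]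
  refine ⟨hc, fun t ht => ?_, fun s => if s ≤ a then g s else g' s, hint, fun t ht => ?_, ?_⟩
  · rw [hxx t ⟨ht.1, ht.2.trans ha.1⟩, hx₀ t ht]
  · have hle : ∀ t ∈ Icc t₀ a, x' t = x' t₀ + ∫ s in t₀..t, if s ≤ a then g s else g' s := by
      intro t ht
      rw [hxx t ⟨ht₀.trans ht.1, ht.2⟩, hxx t₀ ⟨ht₀, ha.1⟩, hgx t ⟨ht.1, ht.2.trans ha.2⟩]
      congr 1
      refine intervalIntegral.integral_congr fun s hs => ?_
      rw [uIcc_of_le ht.1] at hs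
      simp [hs.2.trans ht.2]
    rcases le_total t a with h | h
    · exact hle t ⟨ht.1, h⟩
    · have hii : ∀ p ∈ Icc t₀ T, ∀ q ∈ Icc t₀ T, IntervalIntegrable
          (fun s => if s ≤ a then g s else g' s) volume p q := fun p hp q hq =>
        (hint.mono_set (uIcc_subset_Icc hp hq)).intervalIntegrable
      rw [← intervalIntegral.integral_add_adjacent_intervals
        (hii t₀ ⟨le_rfl, ha.1.trans ha.2⟩ a ha) (hii a ha t ht), ← add_assoc,
        ← hle a ⟨ha.1, le_rfl⟩, hgx' t ⟨h, ht.2⟩]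
      congr 1
      refine intervalIntegral.integral_congr_ae (Eventually.of_forall fun s hs => ?_)
      rw [uIoc_of_le h] at hs
      simp [hs.1]
  · rw [ae_restrict_iff' measurableSet_Ioo] at hgL hgL' ⊢
    filter_upwards [hgL, hgL'] with s h₁ h₂ hs
    split_ifs with hsa
    · rw [runSup_congr fun r hr => hxx r ⟨hr.1, hr.2.trans hsa⟩]
      exact h₁ hs
    · exact h₂ ⟨not_le.1 hsa, hs.2⟩

theorem norm_sub_le_of_XDeriv {L t₀ s t : ℝ} {x g : Path d} (hL : 0 ≤ L)
    (hx : x ∈ Cadlag T d) (hg : XDeriv T d L t₀ x g) (hs : t₀ ≤ s) (hst : s ≤ t) (ht : t ≤ T) :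
    ‖x t - x s‖ ≤ L * (1 + runSup d x t) * (t - s) := by
  obtain ⟨hi, hgx, hgL⟩ := hg
  have hii : ∀ p ∈ Icc t₀ T, ∀ q ∈ Icc t₀ T, IntervalIntegrable g volume p q :=
    fun p hp q hq => (hi.mono_set (uIcc_subset_Icc hp hq)).intervalIntegrable
  have hs' : s ∈ Icc t₀ T := ⟨hs, hst.trans ht⟩
  have ht' : t ∈ Icc t₀ T := ⟨hs.trans hst, ht⟩
  have h₀ : t₀ ∈ Icc t₀ T := ⟨le_rfl, hs'.1.trans hs'.2⟩
  have heq : x t - x s = ∫ r in s..t, g r := by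
    rw [hgx t ht', hgx s hs', ← intervalIntegral.integral_add_adjacent_intervals
      (hii t₀ h₀ s hs') (hii s hs' t ht')]
    abel
  have := intervalIntegral.norm_integral_le_of_norm_le_const_ae (a := s) (b := t) (f := g)
    (C := L * (1 + runSup d x t)) (by
      rw [Measure.restrict_congr_set Ioo_ae_eq_Ioc, ae_restrict_iff' measurableSet_Ioc] at hgL
      filter_upwards [hgL] with r hr hrs
      rw [uIoc_of_le hst] at hrs
      refine (hr ⟨hs.trans_lt hrs.1, hrs.2.trans ht⟩).trans ?_
      have := runSup_mono hx hrs.2 ht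
      gcongr)
  rwa [heq, ← abs_of_nonneg (sub_nonneg.2 hst)]

theorem exists_bound_lipschitz_XSet {L t₀ : ℝ} (ht₀ : 0 ≤ t₀) (ht₀T : t₀ ≤ T) (hL : 0 ≤ L) (x₀ : Path d) :
    ∃ R K : ℝ, 0 ≤ K ∧ ∀ x ∈ XSet T d L t₀ x₀, (∀ t ∈ Icc 0 T, ‖x t‖ ≤ R) ∧
      ∀ s ∈ Icc t₀ T, ∀ t ∈ Icc t₀ T, ‖x t - x s‖ ≤ K * |t - s| := by
  set δ : ℝ := 1 / (2 * (L + 1)) with hδ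
  have hδ0 : 0 < δ := by positivity
  have hLδ : L * δ ≤ 1 / 2 := by
    rw [hδ, mul_one_div, div_le_div_iff₀ (by positivity) (by norm_num)]
    linarith
  have hind : ∀ x ∈ XSet T d L t₀ x₀, ∀ n : ℕ, ∀ t ∈ Icc t₀ T, t ≤ t₀ + n * δ →
      1 + runSup d x t ≤ 2 ^ n * (1 + runSup d x₀ t₀) := by
    rintro x ⟨hx, hx₀, g, hg⟩ n
    induction n with
    | zero =>
      intro t ht htn
      have : t = t₀ := le_antisymm (by simpa using htn) ht.1
      rw [this, runSup_congr hx₀]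
      simp
    | succ n ih =>
      intro t ht htn
      push_cast at htn
      set t' := max t₀ (t - δ) with ht'
      have htt : t' ≤ t := max_le ht.1 (by linarith)
      have ih' := ih t' ⟨le_max_left _ _, htt.trans ht.2⟩
        (max_le (by have : 0 ≤ n * δ := by positivity
                    linarith) (by linarith))
      have hr := runSup_nonneg x t
      have hr' := runSup_nonneg x t'
      have hkey : runSup d x t ≤ runSup d x t' + L * δ * (1 + runSup d x t) := by
        refine runSup_le (by positivity) fun s hs => ?_
        rcases le_total s t' with h | h
        · have := norm_le_runSup hx ⟨hs.1, h⟩ (htt.trans ht.2)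
          have : 0 ≤ L * δ * (1 + runSup d x t) := by positivity
          linarith
        · have h₁ := norm_sub_le_of_XDeriv hL hx hg (le_max_left _ _) h (hs.2.trans ht.2)
          have h₂ := norm_le_runSup hx (s := t') ⟨ht₀.trans (le_max_left _ _), le_rfl⟩
            (htt.trans ht.2)
          have h₃ : s - t' ≤ δ := by linarith [le_max_right t₀ (t - δ), hs.2]
          have h₄ := runSup_mono hx hs.2 ht.2
          have h₅ : L * (1 + runSup d x s) * (s - t') ≤ L * (1 + runSup d x t) * δ := by
            have := runSup_nonneg x s
            have := sub_nonneg.2 h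
            gcongr
          have h₆ := norm_add_le (x t') (x s - x t')
          rw [add_sub_cancel] at h₆
          linarith
      rw [pow_succ]
      nlinarith
  obtain ⟨n, hn⟩ := exists_nat_ge ((T - t₀) / δ)
  rw [div_le_iff₀ hδ0] at hn
  set R := 2 ^ n * (1 + runSup d x₀ t₀) with hR
  have hR0 : 0 ≤ R := by have := runSup_nonneg x₀ t₀; positivity
  have hb : ∀ x ∈ XSet T d L t₀ x₀, ∀ t ∈ Icc t₀ T, runSup d x t ≤ R := fun x hx t ht => by
    linarith [hind x hx n t ht (by linarith [ht.2])]
  refine ⟨R, L * (1 + R), by positivity, fun x hx => ⟨fun t ht => ?_, ?_⟩⟩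
  · rcases le_total t t₀ with h | h
    · exact (norm_le_runSup hx.1 ⟨ht.1, h⟩ ht₀T).trans (hb x hx t₀ ⟨le_rfl, ht₀T⟩)
    · exact (norm_le_runSup hx.1 ⟨ht.1, le_rfl⟩ ht.2).trans
        (hb x hx t ⟨h, ht.2⟩)
  · have hle : ∀ s ∈ Icc t₀ T, ∀ t ∈ Icc t₀ T, s ≤ t →
        ‖x t - x s‖ ≤ L * (1 + R) * (t - s) := by
      intro s hs t ht hst
      have := hb x hx t ht
      obtain ⟨hc, -, g, hg⟩ := hx
      refine (norm_sub_le_of_XDeriv hL hc hg hs.1 hst ht.2).trans ?_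
      have := sub_nonneg.2 hst
      gcongr
    intro s hs t ht
    rcases le_total s t with h | h
    · rw [abs_of_nonneg (sub_nonneg.2 h)]
      exact hle s hs t ht h
    · rw [abs_sub_comm, abs_of_nonneg (sub_nonneg.2 h), norm_sub_rev]
      exact hle t ht s hs h

end Paths

section Compactness

variable {T : ℝ} {d : ℕ}

theorem exists_subseq_uniform_limit {t₀ R K : ℝ} {x₀ : Path d} (ht₀ : 0 ≤ t₀) (ht₀T : t₀ ≤ T)
    (hK : 0 ≤ K) (hx₀ : x₀ ∈ Cadlag T d) (X : ℕ → Path d)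
    (hX₀ : ∀ n, ∀ t ∈ Icc 0 t₀, X n t = x₀ t) (hXR : ∀ n, ∀ t ∈ Icc 0 T, ‖X n t‖ ≤ R)
    (hXK : ∀ n, ∀ s ∈ Icc t₀ T, ∀ t ∈ Icc t₀ T, ‖X n t - X n s‖ ≤ K * |t - s|) :
    ∃ x ∈ Cadlag T d, (∀ s ∈ Icc t₀ T, ∀ t ∈ Icc t₀ T, ‖x t - x s‖ ≤ K * |t - s|) ∧
      ∃ φ : ℕ → ℕ, StrictMono φ ∧
        ∀ ε > 0, ∀ᶠ n in atTop, ∀ t ∈ Icc 0 T, ‖x t - X (φ n) t‖ ≤ ε := by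
  have hlip : ∀ n, LipschitzWith K.toNNReal fun s : Icc t₀ T => X n s := fun n =>
    LipschitzWith.of_dist_le_mul fun s t => by
      rw [dist_eq_norm, Subtype.dist_eq, Real.dist_eq, Real.coe_toNNReal K hK]
      exact hXK n t t.2 s s.2
  let F : ℕ → BoundedContinuousFunction (Icc t₀ T) (E d) := fun n =>
    BoundedContinuousFunction.mkOfCompact ⟨_, (hlip n).continuous⟩
  have hcomp : IsCompact (closure {f : BoundedContinuousFunction (Icc t₀ T) (E d) |
      LipschitzWith K.toNNReal f ∧ ∀ s, f s ∈ Metric.closedBall (0 : E d) R}) := by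
    refine BoundedContinuousFunction.arzela_ascoli _ (isCompact_closedBall 0 R) _
      (fun f s hf => hf.2 s) ?_
    exact (LipschitzWith.uniformEquicontinuous _ K.toNNReal fun f => f.2.1).equicontinuous
  obtain ⟨f, -, φ, hφ, hlim⟩ := hcomp.tendsto_subseq (x := F) fun n => subset_closure
    ⟨hlip n, fun s => by
      rw [mem_closedBall_zero_iff]
      exact hXR n s ⟨ht₀.trans s.2.1, s.2.2⟩⟩
  let x : Path d := fun t => if t < t₀ then x₀ t else IccExtend ht₀T f t
  have hxf : ∀ t (ht : t ∈ Icc t₀ T), x t = f ⟨t, ht⟩ := fun t ht => by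
    simp only [x, if_neg (not_lt.2 ht.1), IccExtend_of_mem ht₀T f ht]
  have hfc : Continuous (IccExtend ht₀T f) := f.continuous.Icc_extend'
  have hunif : ∀ ε > 0, ∀ᶠ n in atTop, ∀ t ∈ Icc 0 T, ‖x t - X (φ n) t‖ ≤ ε := by
    intro ε hε
    filter_upwards [(tendsto_iff_dist_tendsto_zero.1 hlim).eventually (eventually_le_nhds hε)]
      with n hn t ht
    rcases lt_or_ge t t₀ with h | h
    · simp only [x, if_pos h, hX₀ (φ n) t ⟨ht.1, h.le⟩, sub_self, norm_zero, hε.le]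
    · rw [hxf t ⟨h, ht.2⟩, ← dist_eq_norm, dist_comm]
      exact (BoundedContinuousFunction.dist_coe_le_dist (f := F (φ n)) (g := f)
        ⟨t, h, ht.2⟩).trans hn
  refine ⟨x, ⟨fun t ht => ?_, fun t ht => ?_⟩, fun s hs t ht => ?_, φ, hφ, hunif⟩
  · rcases lt_or_ge t t₀ with h | h
    · refine (hx₀.1 t ht).congr_of_eventuallyEq ?_ (if_pos h)
      filter_upwards [mem_nhdsWithin_of_mem_nhds (Iio_mem_nhds h)] with s hs using if_pos hs
    · refine hfc.continuousWithinAt.congr (fun s hs => ?_) (if_neg (not_lt.2 h))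
      exact if_neg (not_lt.2 (h.trans hs))
  · rcases le_or_gt t t₀ with h | h
    · obtain ⟨l, hl⟩ := hx₀.2 t ht
      refine ⟨l, hl.congr' ?_⟩
      filter_upwards [self_mem_nhdsWithin] with s hs
      exact (if_pos (lt_of_lt_of_le hs h)).symm
    · refine ⟨_, (hfc.continuousWithinAt (s := Iio t) (x := t)).tendsto.congr' ?_⟩
      filter_upwards [mem_nhdsWithin_of_mem_nhds (Ioi_mem_nhds h)] with s hs
      exact (if_neg (not_lt.2 (le_of_lt hs))).symm
  · refine le_of_forall_pos_le_add fun ε hε => ?_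
    obtain ⟨n, hn⟩ := (hunif (ε / 2) (by positivity)).exists
    have h₁ := hn t ⟨ht₀.trans ht.1, ht.2⟩
    have h₂ := hn s ⟨ht₀.trans hs.1, hs.2⟩
    have h₃ := hXK (φ n) s hs t ht
    have : x t - x s = (x t - X (φ n) t) + (X (φ n) t - X (φ n) s) - (x s - X (φ n) s) := by
      abel
    rw [this]
    have h₄ := norm_sub_le ((x t - X (φ n) t) + (X (φ n) t - X (φ n) s)) (x s - X (φ n) s)
    have h₅ := norm_add_le (x t - X (φ n) t) (X (φ n) t - X (φ n) s)
    linarith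

theorem dInf_le_of_uniform {t₀ s t K ε : ℝ} {x x' : Path d} (ht₀ : 0 ≤ t₀) (hK : 0 ≤ K)
    (hε : 0 ≤ ε) (hs : s ∈ Icc t₀ T) (ht : t ∈ Icc t₀ T)
    (hx : ∀ s ∈ Icc t₀ T, ∀ t ∈ Icc t₀ T, ‖x t - x s‖ ≤ K * |t - s|)
    (hxx : ∀ r ∈ Icc 0 T, ‖x r - x' r‖ ≤ ε) :
    dInf T d (t, x) (s, x') ≤ (1 + K) * |t - s| + ε := by
  have : stopDist T d t x s x' ≤ K * |t - s| + ε := by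
    refine Real.sSup_le ?_ (by positivity)
    rintro _ ⟨r, hr, rfl⟩
    have h₁ : ‖x (min r t) - x (min r s)‖ ≤ K * |t - s| := by
      rcases le_total r t₀ with h | h
      · rw [min_eq_left (h.trans ht.1), min_eq_left (h.trans hs.1), sub_self, norm_zero]
        positivity
      · refine (hx _ ⟨le_min h hs.1, (min_le_left _ _).trans hr.2⟩ _
          ⟨le_min h ht.1, (min_le_left _ _).trans hr.2⟩).trans ?_
        have := abs_min_sub_min_le_max r t r s
        rw [sub_self, abs_zero, max_eq_right (abs_nonneg _)] at this
        gcongr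
    have h₂ := hxx (min r s) ⟨le_min hr.1 (ht₀.trans hs.1), (min_le_left _ _).trans hr.2⟩
    have h₃ := norm_add_le (x (min r t) - x (min r s)) (x (min r s) - x' (min r s))
    rw [sub_add_sub_cancel] at h₃
    exact h₃.trans (add_le_add h₁ h₂)
  simp only [dInf]
  linarith

theorem UscOn.exists_bound {L t₀ : ℝ} {x₀ : Path d} {u : ℝ → Path d → ℝ} (hu : UscOn T d u)
    (ht₀ : 0 ≤ t₀) (ht₀T : t₀ ≤ T) (hL : 0 ≤ L) (hx₀ : x₀ ∈ Cadlag T d) :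
    ∃ C, ∀ t ∈ Icc t₀ T, ∀ x ∈ XSet T d L t₀ x₀, u t x ≤ C := by
  by_contra! hcon
  obtain ⟨R, K, hK, hRK⟩ := exists_bound_lipschitz_XSet (T := T) ht₀ ht₀T hL x₀
  choose τ hτ X hX hlt using fun n : ℕ => hcon n
  obtain ⟨t, ht, ψ, hψ, hlim⟩ := isCompact_Icc.tendsto_subseq hτ
  obtain ⟨x, hx, hxK, φ, hφ, hunif⟩ := exists_subseq_uniform_limit ht₀ ht₀T hK hx₀
    (fun n => X (ψ n)) (fun n => (hX _).2.1) (fun n => (hRK _ (hX _)).1)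
    (fun n => (hRK _ (hX _)).2)
  obtain ⟨δ, hδ, hδu⟩ := hu t ⟨ht₀.trans ht.1, ht.2⟩ x hx (u t x + 1) (lt_add_one _)
  have hlim' : Tendsto (fun n => (1 + K) * |t - τ (ψ (φ n))|) atTop (𝓝 0) := by
    have := ((tendsto_const_nhds (x := t)).sub (hlim.comp hφ.tendsto_atTop)).abs.const_mul (1 + K)
    simpa using this
  obtain ⟨N, hN⟩ := exists_nat_ge (u t x + 1)
  obtain ⟨n, h₁, h₂, h₃⟩ := ((hunif (δ / 2) (by positivity)).and
    ((hlim'.eventually (gt_mem_nhds (half_pos hδ))).and (eventually_ge_atTop N))).exists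
  have h₄ := hδu (τ (ψ (φ n))) ⟨ht₀.trans (hτ _).1, (hτ _).2⟩ _ (hX _).1
    ((dInf_le_of_uniform ht₀ hK (half_pos hδ).le (hτ _) ht hxK h₁).trans_lt (by linarith))
  have h₅ : (N : ℝ) ≤ ψ (φ n) := by
    exact_mod_cast h₃.trans ((hφ.id_le n).trans (hψ.id_le _))
  linarith [hlt (ψ (φ n))]

end Compactness

section Gauge

variable {V : Type*} [NormedAddCommGroup V]

/-- A substitute for the squared supremum norm that is differentiable along paths: here `n` is
the running supremum of the norm and `w` the current value. -/
def gauge (n : ℝ) (w : V) : ℝ := n ^ 2 + ‖w‖ ^ 4 / n ^ 2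

theorem sq_le_gauge (n : ℝ) (w : V) : n ^ 2 ≤ gauge n w :=
  le_add_of_nonneg_right (by positivity)

variable [InnerProductSpace ℝ V]

/-- The derivative of `gauge` in the direction of the current value. -/
def gaugeGrad (n : ℝ) (w : V) : V := (4 * (‖w‖ ^ 2 / n ^ 2)) • w

theorem norm_gaugeGrad_le {n : ℝ} {w : V} (hw : ‖w‖ ≤ n) : ‖gaugeGrad n w‖ ≤ 4 * n := by
  have h₁ : ‖w‖ ^ 2 / n ^ 2 ≤ 1 := div_le_one_of_le₀ (by gcongr) (by positivity)
  rw [gaugeGrad, norm_smul, Real.norm_of_nonneg (by positivity)]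
  nlinarith [norm_nonneg w]

theorem gauge_le_of_fixed_sup {n h : ℝ} {w w' : V} (hn : 0 < n) (hw : ‖w‖ ≤ n) (hw' : ‖w'‖ ≤ n)
    (hh : ‖w' - w‖ ≤ h) :
    gauge n w' ≤ gauge n w + 4 * (‖w‖ ^ 2 / n ^ 2) * ⟪w, w' - w⟫_ℝ + 6 * h ^ 2 := by
  have hq : ‖w'‖ ^ 2 = ‖w‖ ^ 2 + 2 * ⟪w, w' - w⟫_ℝ + ‖w' - w‖ ^ 2 := by
    rw [← norm_add_sq_real, add_sub_cancel]
  have hr : ‖w' - w‖ ^ 2 ≤ h ^ 2 := by gcongr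
  have habs : |‖w'‖ - ‖w‖| ≤ h := (abs_norm_sub_norm_le w' w).trans hh
  have hd : (‖w'‖ ^ 2 - ‖w‖ ^ 2) ^ 2 ≤ 4 * n ^ 2 * h ^ 2 := by
    have h₁ : (‖w'‖ - ‖w‖) ^ 2 ≤ h ^ 2 := by
      rw [← sq_abs]; gcongr
    have h₂ : (‖w'‖ + ‖w‖) ^ 2 ≤ (2 * n) ^ 2 := by
      gcongr; linarith
    calc (‖w'‖ ^ 2 - ‖w‖ ^ 2) ^ 2 = (‖w'‖ - ‖w‖) ^ 2 * (‖w'‖ + ‖w‖) ^ 2 := by ring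
      _ ≤ h ^ 2 * (2 * n) ^ 2 := by gcongr
      _ = _ := by ring
  have hwn : ‖w‖ ^ 2 ≤ n ^ 2 := by gcongr
  have hfin : ‖w'‖ ^ 4 ≤ ‖w‖ ^ 4 + 4 * ‖w‖ ^ 2 * ⟪w, w' - w⟫_ℝ + 6 * h ^ 2 * n ^ 2 := by
    have h₁ : ‖w‖ ^ 2 * ‖w' - w‖ ^ 2 ≤ n ^ 2 * h ^ 2 := by gcongr
    have h₂ : ‖w'‖ ^ 4 - ‖w‖ ^ 4 =
        2 * ‖w‖ ^ 2 * (‖w'‖ ^ 2 - ‖w‖ ^ 2) + (‖w'‖ ^ 2 - ‖w‖ ^ 2) ^ 2 := by ring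
    have h₃ : 2 * ‖w‖ ^ 2 * (‖w'‖ ^ 2 - ‖w‖ ^ 2) =
        4 * ‖w‖ ^ 2 * ⟪w, w' - w⟫_ℝ + 2 * (‖w‖ ^ 2 * ‖w' - w‖ ^ 2) := by rw [hq]; ring
    linarith
  have hdiv : ‖w'‖ ^ 4 / n ^ 2 ≤
      (‖w‖ ^ 4 + 4 * ‖w‖ ^ 2 * ⟪w, w' - w⟫_ℝ + 6 * h ^ 2 * n ^ 2) / n ^ 2 := by gcongr
  have heq : (‖w‖ ^ 4 + 4 * ‖w‖ ^ 2 * ⟪w, w' - w⟫_ℝ + 6 * h ^ 2 * n ^ 2) / n ^ 2 =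
      ‖w‖ ^ 4 / n ^ 2 + 4 * (‖w‖ ^ 2 / n ^ 2) * ⟪w, w' - w⟫_ℝ + 6 * h ^ 2 := by
    field_simp
  unfold gauge
  linarith

/-- Second-order upper expansion of `gauge`, uniform up to the origin. -/
theorem gauge_le_expansion {n n' h : ℝ} {w w' : V} (hw : ‖w‖ ≤ n) (hw' : ‖w'‖ ≤ n')
    (hnn : n ≤ n') (hn' : n' ≤ max n (‖w‖ + h)) (hh : ‖w' - w‖ ≤ h) :
    gauge n' w' ≤ gauge n w + ⟪gaugeGrad n w, w' - w⟫_ℝ + 22 * h ^ 2 := by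
  have hn0 : 0 ≤ n := (norm_nonneg w).trans hw
  rw [gaugeGrad, real_inner_smul_left]
  rcases hn0.eq_or_lt with rfl | hn
  · have hw0 : w = 0 := by simpa using hw
    subst hw0
    rw [norm_zero, zero_add] at hn'
    have hh0 : 0 ≤ h := (norm_nonneg _).trans hh
    rw [max_eq_right hh0] at hn'
    have h₁ : ‖w'‖ ^ 4 / n' ^ 2 ≤ h ^ 2 := by
      refine div_le_of_le_mul₀ (by positivity) (by positivity) ?_
      calc ‖w'‖ ^ 4 = ‖w'‖ ^ 2 * ‖w'‖ ^ 2 := by ring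
        _ ≤ h ^ 2 * n' ^ 2 := by
          have : ‖w'‖ ≤ h := hw'.trans hn'
          gcongr
    have h₂ : n' ^ 2 ≤ h ^ 2 := by gcongr
    simp only [gauge, norm_zero]
    norm_num
    nlinarith
  have hfix := gauge_le_of_fixed_sup (hn.trans_le hnn) (hw.trans hnn) hw' hh
  rcases hnn.eq_or_lt with rfl | hlt
  · nlinarith [sq_nonneg h]
  have hnh : n' ≤ ‖w‖ + h := by
    rcases le_max_iff.1 hn' with h' | h'
    · exact absurd h' (not_le.2 hlt)
    · exact h'
  have hn'0 : 0 < n' := hn.trans hlt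
  have hh0 : 0 ≤ h := (norm_nonneg _).trans hh
  set a := ‖w‖ with ha
  have ha0 : 0 ≤ a := norm_nonneg w
  have hd : n' ^ 2 - n ^ 2 ≤ 2 * h * n' := by nlinarith
  have hd0 : 0 ≤ n' ^ 2 - n ^ 2 := by nlinarith
  have h₁ : gauge n' w - gauge n w ≤ 8 * h ^ 2 := by
    have heq : gauge n' w - gauge n w = (n' ^ 2 - n ^ 2) * (1 - a ^ 4 / (n ^ 2 * n' ^ 2)) := by
      simp only [gauge, ← ha]
      field_simp
      ring
    have h₂ : 1 - a ^ 4 / (n ^ 2 * n' ^ 2) ≤ 4 * h / n' := by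
      have : a ^ 4 / (n' ^ 2 * n' ^ 2) ≤ a ^ 4 / (n ^ 2 * n' ^ 2) := by gcongr
      have h₃ : 1 - a ^ 4 / (n' ^ 2 * n' ^ 2) ≤ 4 * h / n' := by
        rw [sub_le_iff_le_add, div_add_div _ _ hn'0.ne' (by positivity),
          one_le_div (by positivity)]
        have han : a ≤ n' := hw.trans hnn
        have h₄ : n' ^ 4 - a ^ 4 ≤ 4 * h * n' ^ 3 := by
          have e₁ : (n' - a) ≤ h := by linarith
          have e₂ : (n' + a) * (n' ^ 2 + a ^ 2) ≤ (2 * n') * (2 * n' ^ 2) := by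
            have : a ^ 2 ≤ n' ^ 2 := by gcongr
            gcongr <;> linarith
          calc n' ^ 4 - a ^ 4 = (n' - a) * ((n' + a) * (n' ^ 2 + a ^ 2)) := by ring
            _ ≤ h * ((2 * n') * (2 * n' ^ 2)) := by
              have : 0 ≤ (n' + a) * (n' ^ 2 + a ^ 2) := by positivity
              gcongr
            _ = _ := by ring
        nlinarith
      linarith
    rw [heq]
    calc (n' ^ 2 - n ^ 2) * (1 - a ^ 4 / (n ^ 2 * n' ^ 2)) ≤ (n' ^ 2 - n ^ 2) * (4 * h / n') := by
          gcongr
      _ ≤ (2 * h * n') * (4 * h / n') := by gcongr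
      _ = 8 * h ^ 2 := by field_simp; ring
  have h₂ : 4 * (a ^ 2 / n' ^ 2) * ⟪w, w' - w⟫_ℝ - 4 * (a ^ 2 / n ^ 2) * ⟪w, w' - w⟫_ℝ
      ≤ 8 * h ^ 2 := by
    have hin : |⟪w, w' - w⟫_ℝ| ≤ n' * h :=
      (abs_real_inner_le_norm w (w' - w)).trans (by
        have : ‖w‖ ≤ n' := hw.trans hnn
        gcongr)
    have heq : 4 * (a ^ 2 / n' ^ 2) * ⟪w, w' - w⟫_ℝ - 4 * (a ^ 2 / n ^ 2) * ⟪w, w' - w⟫_ℝ =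
        4 * (a ^ 2 / n ^ 2) * ((n' ^ 2 - n ^ 2) / n' ^ 2) * (-⟪w, w' - w⟫_ℝ) := by
      field_simp
      ring
    have h₃ : a ^ 2 / n ^ 2 ≤ 1 := div_le_one_of_le₀ (by gcongr) (by positivity)
    have h₄ : -⟪w, w' - w⟫_ℝ ≤ n' * h := (neg_le_abs _).trans hin
    rw [heq]
    calc 4 * (a ^ 2 / n ^ 2) * ((n' ^ 2 - n ^ 2) / n' ^ 2) * (-⟪w, w' - w⟫_ℝ)
        ≤ 4 * (a ^ 2 / n ^ 2) * ((n' ^ 2 - n ^ 2) / n' ^ 2) * (n' * h) := by gcongr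
      _ ≤ 4 * 1 * ((2 * h * n') / n' ^ 2) * (n' * h) := by gcongr
      _ = 8 * h ^ 2 := by field_simp; ring
  linarith

end Gauge

section Doubling

variable {T : ℝ} {d : ℕ} {H : Ham d} {M : ℝ → ℝ} {L t₀ : ℝ} {x₀ : Path d}

theorem HamLipX.ae_forall (hH4 : HamLipX T d H M) (hH1 : HamCont T d H) (hL : 0 ≤ L)
    (ht₀ : t₀ ∈ Ico 0 T) (hx₀ : x₀ ∈ Cadlag T d) {x x' : Path d} (hx : x ∈ XSet T d L t₀ x₀)
    (hx' : x' ∈ XSet T d L t₀ x₀) (z : E d) :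
    ∀ᵐ t ∂(volume.restrict (Ioo t₀ T)), ∀ y : ℝ, |H t x y z - H t x' y z| ≤
      M L * (1 + |y| + ‖z‖) * runSup d (fun s => x s - x' s) t := by
  have hcont := ae_restrict_of_ae_restrict_of_subset (Ioo_subset_Ioo_left ht₀.1) hH1
  have hrat : ∀ᵐ t ∂(volume.restrict (Ioo t₀ T)), ∀ q : ℚ, |H t x q z - H t x' q z| ≤
      M L * (1 + |(q : ℝ)| + ‖z‖) * runSup d (fun s => x s - x' s) t :=
    ae_all_iff.2 fun q => (hH4 L hL).2 t₀ ht₀ x₀ hx₀ x hx x' hx' q z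
  filter_upwards [hcont, hrat] with t hc hq y
  have hcy : ∀ x ∈ Cadlag T d, Continuous fun y => H t x y z := fun x hx =>
    Metric.continuous_iff.2 fun y ε hε => by
      obtain ⟨δ, hδ, hδH⟩ := hc x hx y z ε hε
      refine ⟨δ, hδ, fun y' hy' => ?_⟩
      rw [Real.dist_eq, abs_sub_comm]
      rw [Real.dist_eq, abs_sub_comm] at hy'
      refine hδH x hx y' z ?_ hy' (by simpa using hδ)
      exact (Real.sSup_le (by rintro _ ⟨s, -, rfl⟩; simp) le_rfl).trans_lt hδ
  refine DenseRange.induction_on (p := fun y => |H t x y z - H t x' y z| ≤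
    M L * (1 + |y| + ‖z‖) * runSup d (fun s => x s - x' s) t) Rat.denseRange_cast y
    (isClosed_le ?_ ?_) hq
  · exact ((hcy x hx.1).sub (hcy x' hx'.1)).abs
  · fun_prop

/-- Characteristics of a sub- and a supersolution for the same `z` separate at a controlled rate
as long as they stay ordered. -/
theorem exists_doubled_characteristics {h : Path d → ℝ} {u v : ℝ → Path d → ℝ}
    (hH1 : HamCont T d H) (hH4 : HamLipX T d H M) (hH5 : HamMono T d H) (hL : 0 ≤ L)
    (hu : MinimaxSub T d H h L u) (hv : MinimaxSuper T d H h L v)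
    (ht₀ : t₀ ∈ Ico 0 T) (hx₀ : x₀ ∈ Cadlag T d) {Y : ℝ}
    (hYu : ∀ t ∈ Icc t₀ T, ∀ x ∈ XSet T d L t₀ x₀, u t x ≤ Y)
    (hYv : ∀ t ∈ Icc t₀ T, ∀ x ∈ XSet T d L t₀ x₀, -Y ≤ v t x)
    {a : ℝ} (ha : a ∈ Ico t₀ T) {x₁ x₂ : Path d} (hx₁ : x₁ ∈ XSet T d L t₀ x₀)
    (hx₂ : x₂ ∈ XSet T d L t₀ x₀) {y₁ y₂ : ℝ} (hy₁ : y₁ ≤ u a x₁) (hy₂ : v a x₂ ≤ y₂) (z : E d) :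
    ∃ x ∈ XSet T d L t₀ x₀, ∃ x' ∈ XSet T d L t₀ x₀, ∃ y y' : ℝ → ℝ,
      (∀ t ∈ Icc 0 a, x t = x₁ t) ∧ (∀ t ∈ Icc 0 a, x' t = x₂ t) ∧
      ContinuousOn y (Icc a T) ∧ ContinuousOn y' (Icc a T) ∧
      (∀ t ∈ Icc a T, y t ≤ u t x) ∧ (∀ t ∈ Icc a T, v t x' ≤ y' t) ∧
      ∀ τ ∈ Icc a T, (∀ s ∈ Ico a τ, y' s ≤ y s) →
        y₁ - y₂ + ⟪z, (x τ - x' τ) - (x a - x' a)⟫_ℝ -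
          (τ - a) * (M L * (1 + Y + ‖z‖) * runSup d (fun s => x s - x' s) τ) ≤ y τ - y' τ := by
  have ha0 : 0 ≤ a := ht₀.1.trans ha.1
  obtain ⟨⟨x, y⟩, ⟨hxc, hxeq, hyc, g, hg, hint, hy⟩, hyu⟩ :=
    hu.2.2 a ⟨ha0, ha.2⟩ x₁ hx₁.1 z y₁ hy₁
  obtain ⟨⟨x', y'⟩, ⟨hxc', hxeq', hyc', g', hg', hint', hy'⟩, hyv⟩ :=
    hv.2.2 a ⟨ha0, ha.2⟩ x₂ hx₂.1 z y₂ hy₂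
  dsimp only at hxc hxeq hyc hg hint hy hyu hxc' hxeq' hyc' hg' hint' hy' hyv
  have hxX : x ∈ XSet T d L t₀ x₀ :=
    mem_XSet_trans ht₀.1 ⟨ha.1, ha.2.le⟩ hx₁ ⟨hxc, hxeq, g, hg⟩
  have hxX' : x' ∈ XSet T d L t₀ x₀ :=
    mem_XSet_trans ht₀.1 ⟨ha.1, ha.2.le⟩ hx₂ ⟨hxc', hxeq', g', hg'⟩
  refine ⟨x, hxX, x', hxX', y, y', hxeq, hxeq', hyc, hyc', hyu, hyv, fun τ hτ hord => ?_⟩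
  have hii : ∀ {F : Type} [NormedAddCommGroup F] {f : ℝ → F}, IntegrableOn f (Icc a T) →
      IntervalIntegrable f volume a τ := fun hf =>
    (hf.mono_set (uIcc_subset_Icc ⟨le_rfl, ha.2.le⟩ hτ)).intervalIntegrable
  have hinner : ∀ {x g : Path d}, XDeriv T d L a x g →
      (∫ s in a..τ, ⟪z, g s⟫_ℝ) = ⟪z, x τ - x a⟫_ℝ := fun {x g} hg => by
    have h₁ := (innerSL ℝ z).intervalIntegral_comp_comm (hii hg.1)
    simp only [innerSL_apply_apply] at h₁
    rw [h₁, hg.2.1 τ hτ, add_sub_cancel_left]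
  set B := M L * (1 + Y + ‖z‖) * runSup d (fun s => x s - x' s) τ with hB
  have hdiff : y τ - y' τ = y₁ - y₂ + ∫ s in a..τ,
      ((⟪g s, z⟫_ℝ - H s x (y s) z) - (⟪g' s, z⟫_ℝ - H s x' (y' s) z)) := by
    rw [intervalIntegral.integral_sub (hii hint) (hii hint'), hy τ hτ, hy' τ hτ]
    ring
  have hiz : ∀ {g : Path d}, IntegrableOn g (Icc a T) →
      IntervalIntegrable (fun s => ⟪z, g s⟫_ℝ) volume a τ := fun hg =>
    hii ((innerSL ℝ z).integrable_comp hg)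
  have hmono : (∫ s in a..τ, (⟪z, g s⟫_ℝ - ⟪z, g' s⟫_ℝ - B)) ≤ ∫ s in a..τ,
      ((⟪g s, z⟫_ℝ - H s x (y s) z) - (⟪g' s, z⟫_ℝ - H s x' (y' s) z)) := by
    refine intervalIntegral.integral_mono_ae_restrict hτ.1
      (((hiz hg.1).sub (hiz hg'.1)).sub intervalIntegrable_const)
      ((hii hint).sub (hii hint')) ?_
    rw [← Measure.restrict_congr_set Ioo_ae_eq_Icc]
    have hlip := ae_restrict_of_ae_restrict_of_subset (Ioo_subset_Ioo ha.1 hτ.2)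
      (hH4.ae_forall hH1 hL ht₀ hx₀ hxX hxX' z)
    have hmon := ae_restrict_of_ae_restrict_of_subset (Ioo_subset_Ioo ha0 hτ.2) hH5
    filter_upwards [hlip, hmon, ae_restrict_mem measurableSet_Ioo] with s h₁ h₂ hs
    have hsT : s ∈ Icc a T := ⟨hs.1.le, hs.2.le.trans hτ.2⟩
    have hst₀ : s ∈ Icc t₀ T := ⟨ha.1.trans hsT.1, hsT.2⟩
    have hle := hord s ⟨hs.1.le, hs.2⟩
    have hY : |y' s| ≤ Y := abs_le.2 ⟨(hYv s hst₀ x' hxX').trans (hyv s hsT),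
      hle.trans ((hyu s hsT).trans (hYu s hst₀ x hxX))⟩
    have h₃ := h₂ x hxc z _ _ hle
    have h₄ : H s x (y' s) z - H s x' (y' s) z ≤ B := by
      refine (le_abs_self _).trans ((h₁ (y' s)).trans ?_)
      have hM := (hH4 L hL).1
      have hr := runSup_mono (sub_mem_cadlag hxc hxc') hs.2.le hτ.2
      have := runSup_nonneg (fun s => x s - x' s) s
      have hY0 : 0 ≤ Y := (abs_nonneg _).trans hY
      rw [hB]
      gcongr
    rw [real_inner_comm z (g s), real_inner_comm z (g' s)]
    linarith
  rw [intervalIntegral.integral_sub ((hiz hg.1).sub (hiz hg'.1)) intervalIntegrable_const,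
    intervalIntegral.integral_sub (hiz hg.1) (hiz hg'.1), hinner hg, hinner hg',
    intervalIntegral.integral_const, smul_eq_mul] at hmono
  have : (x τ - x' τ) - (x a - x' a) = (x τ - x a) - (x' τ - x' a) := by abel
  rw [this, inner_sub_right, hdiff]
  linarith

theorem pos_of_forall_nonneg_before {f : ℝ → ℝ} {a b : ℝ} (hf : ContinuousOn f (Icc a b))
    (h : ∀ τ ∈ Icc a b, (∀ s ∈ Ico a τ, 0 ≤ f s) → 0 < f τ) : ∀ τ ∈ Icc a b, 0 < f τ := by
  by_contra! hcon
  obtain ⟨s, hs, hfs⟩ := hcon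
  have hc : IsCompact (Icc a b ∩ f ⁻¹' Iic 0) :=
    isCompact_Icc.of_isClosed_subset (hf.preimage_isClosed_of_isClosed isClosed_Icc isClosed_Iic)
      inter_subset_left
  obtain ⟨τ, hτ, hmin⟩ := hc.exists_isLeast ⟨s, hs, hfs⟩
  refine (h τ hτ.1 fun r hr => ?_).not_ge hτ.2
  by_contra! hneg
  exact hr.2.not_ge (hmin ⟨⟨hr.1, hr.2.le.trans hτ.1.2⟩, hneg.le⟩)

theorem energy_estimate {m lam δ δ₀ κ k B Y Z ca cb Sa Sb Da Db p na nb : ℝ} (hm : 0 ≤ m)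
    (hlam : lam = 12 * m + 1) (hδ : 0 ≤ δ) (hδ₀ : δ ≤ δ₀) (hcb : 0 < cb) (hca : 0 < ca)
    (hcab : cb * (1 + lam * δ) ≤ ca) (hca3 : ca ≤ 3 * cb) (hcaκ : ca ≤ κ)
    (hna : na ≤ nb) (hnb : 0 ≤ nb) (hZ : Z ≤ ca * (4 * na)) (hB : (m * (1 + Y)) ^ 2 ≤ B * cb)
    (hnS : nb ^ 2 ≤ Sb) (hS : Sb ≤ Sa + p + 22 * (k * δ) ^ 2)
    (hD : Da + ca * p - δ * (m * (1 + Y + Z) * nb) ≤ Db) :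
    Da - ca * Sa - (22 * κ * k ^ 2 * δ₀ + B) * δ ≤ Db - cb * Sb := by
  have h₁ : m * (1 + Y) * nb ≤ cb * nb ^ 2 + B := by
    have : 0 ≤ cb * (cb * nb ^ 2 + B - m * (1 + Y) * nb) := by
      nlinarith [sq_nonneg (cb * nb - m * (1 + Y)), sq_nonneg (cb * nb + m * (1 + Y)),
        sq_nonneg (cb * nb), sq_nonneg (m * (1 + Y))]
    linarith [nonneg_of_mul_nonneg_right this hcb]
  have h₂ : m * Z * nb ≤ 12 * m * (cb * nb ^ 2) := by
    calc m * Z * nb ≤ m * (3 * cb * (4 * nb)) * nb := by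
          gcongr
          refine hZ.trans ?_
          calc ca * (4 * na) ≤ ca * (4 * nb) := by gcongr
            _ ≤ 3 * cb * (4 * nb) := by gcongr
      _ = _ := by ring
  have h₃ : m * (1 + Y + Z) * nb ≤ lam * (cb * Sb) + B := by
    have : lam * (cb * nb ^ 2) ≤ lam * (cb * Sb) := by
      have : 0 ≤ lam := by rw [hlam]; positivity
      gcongr
    rw [hlam] at this ⊢
    linarith
  have hSb : 0 ≤ Sb := (sq_nonneg nb).trans hnS
  have h₄ : cb * (1 + lam * δ) * Sb ≤ ca * Sb := by gcongr
  have h₅ : ca * Sb ≤ ca * (Sa + p + 22 * (k * δ) ^ 2) := by gcongr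
  have h₆ : ca * (22 * (k * δ) ^ 2) ≤ 22 * κ * k ^ 2 * δ₀ * δ := by
    calc ca * (22 * (k * δ) ^ 2) = 22 * ca * k ^ 2 * δ * δ := by ring
      _ ≤ _ := by
        have := hca.le.trans hcaκ
        gcongr
  have h₇ := mul_le_mul_of_nonneg_left h₃ hδ
  linarith

end Doubling

section Comparison

variable {T : ℝ} {d : ℕ} {H : Ham d} {M : ℝ → ℝ} {L t₀ : ℝ} {x₀ : Path d}

/-- The penalized gap between values `y`, `y'` along two paths at time `t`. -/
def energy (κ lam t : ℝ) (x x' : Path d) (y y' : ℝ) : ℝ :=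
  y - y' - κ * Real.exp (-(lam * t)) * gauge (runSup d (fun s => x s - x' s) t) (x t - x' t)

theorem exists_energy_step {h : Path d → ℝ} {u v : ℝ → Path d → ℝ}
    (hH1 : HamCont T d H) (hH4 : HamLipX T d H M) (hH5 : HamMono T d H) (hL : 0 ≤ L)
    (hu : MinimaxSub T d H h L u) (hv : MinimaxSuper T d H h L v)
    (ht₀ : t₀ ∈ Ico 0 T) (hx₀ : x₀ ∈ Cadlag T d) {Y K κ δ₀ B lam : ℝ}
    (hYu : ∀ t ∈ Icc t₀ T, ∀ x ∈ XSet T d L t₀ x₀, u t x ≤ Y)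
    (hYv : ∀ t ∈ Icc t₀ T, ∀ x ∈ XSet T d L t₀ x₀, -Y ≤ v t x)
    (hK : ∀ x ∈ XSet T d L t₀ x₀, ∀ s ∈ Icc t₀ T, ∀ t ∈ Icc t₀ T, ‖x t - x s‖ ≤ K * |t - s|)
    (hK0 : 0 ≤ K) (hκ : 0 < κ) (hlam : lam = 12 * M L + 1) (hlamδ : lam * δ₀ ≤ 1) (hB0 : 0 ≤ B)
    (hB : (M L * (1 + Y)) ^ 2 ≤ B * (κ * Real.exp (-(lam * T))))
    {a b : ℝ} (ha : t₀ ≤ a) (hab : a < b) (hb : b ≤ T) (hbδ : b - a ≤ δ₀)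
    {x₁ x₂ : Path d} (hx₁ : x₁ ∈ XSet T d L t₀ x₀)
    (hx₂ : x₂ ∈ XSet T d L t₀ x₀) {y₁ y₂ : ℝ} (hy₁ : y₁ ≤ u a x₁) (hy₂ : v a x₂ ≤ y₂)
    (hpos : (22 * κ * (2 * K) ^ 2 * δ₀ + B) * (b - a) < energy κ lam a x₁ x₂ y₁ y₂) :
    ∃ x ∈ XSet T d L t₀ x₀, ∃ x' ∈ XSet T d L t₀ x₀, ∃ y y' : ℝ, y ≤ u b x ∧ v b x' ≤ y' ∧
      energy κ lam a x₁ x₂ y₁ y₂ - (22 * κ * (2 * K) ^ 2 * δ₀ + B) * (b - a) ≤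
        energy κ lam b x x' y y' := by
  have hm := (hH4 L hL).1
  have hlam0 : 0 ≤ lam := by rw [hlam]; positivity
  have ha0 : 0 ≤ a := ht₀.1.trans ha
  have hδ₀ : 0 ≤ δ₀ := by linarith
  set c : ℝ → ℝ := fun t => κ * Real.exp (-(lam * t)) with hc
  have hc0 : ∀ t, 0 < c t := fun t => by positivity
  obtain ⟨x, hx, x', hx', y, y', hxa, hxa', hyc, hyc', hyu, hyv, hdec⟩ :=
    exists_doubled_characteristics hH1 hH4 hH5 hL hu hv ht₀ hx₀ hYu hYv ⟨ha, hab.trans_le hb⟩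
      hx₁ hx₂ hy₁ hy₂
      (c a • gaugeGrad (runSup d (fun s => x₁ s - x₂ s) a) (x₁ a - x₂ a))
  set w : Path d := fun s => x s - x' s with hw
  have hwc : w ∈ Cadlag T d := sub_mem_cadlag hx.1 hx'.1
  have haa : a ∈ Icc 0 a := ⟨ha0, le_rfl⟩
  have hsup : runSup d (fun s => x₁ s - x₂ s) a = runSup d w a :=
    runSup_congr fun s hs => by simp only [hw, hxa s hs, hxa' s hs]
  have hwa : x₁ a - x₂ a = w a := by simp only [hw, hxa a haa, hxa' a haa]
  have hwn : ∀ t ∈ Icc 0 T, ‖w t‖ ≤ runSup d w t := fun t ht =>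
    norm_le_runSup hwc ⟨ht.1, le_rfl⟩ ht.2
  have haT : a ∈ Icc 0 T := ⟨ha0, hab.le.trans hb⟩
  have hwK : ∀ s ∈ Icc a T, ‖w s - w a‖ ≤ 2 * K * (s - a) := fun s hs => by
    have h₁ := hK x hx a ⟨ha, haT.2⟩ s ⟨ha.trans hs.1, hs.2⟩
    have h₂ := hK x' hx' a ⟨ha, haT.2⟩ s ⟨ha.trans hs.1, hs.2⟩
    have h₃ := norm_sub_le (x s - x a) (x' s - x' a)
    have h₄ : w s - w a = (x s - x a) - (x' s - x' a) := by simp only [hw]; abel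
    rw [abs_of_nonneg (sub_nonneg.2 hs.1)] at h₁ h₂
    rw [h₄]
    linarith
  simp only [energy, hsup, hwa] at hpos hdec ⊢
  have hest : ∀ τ ∈ Icc a b, (∀ s ∈ Ico a τ, 0 ≤ y s - y' s) →
      y₁ - y₂ - c a * gauge (runSup d w a) (w a) -
        (22 * κ * (2 * K) ^ 2 * δ₀ + B) * (τ - a) ≤
      y τ - y' τ - c τ * gauge (runSup d w τ) (w τ) := by
    intro τ hτ hord
    have hτT : τ ∈ Icc a T := ⟨hτ.1, hτ.2.trans hb⟩
    have hδ : 0 ≤ τ - a := sub_nonneg.2 hτ.1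
    have hδ' : τ - a ≤ δ₀ := by linarith [hτ.2]
    have hcc : c τ * Real.exp (lam * (τ - a)) = c a := by
      simp only [hc]
      rw [mul_assoc, ← Real.exp_add]
      ring_nf
    have hle1 : lam * (τ - a) ≤ 1 := by
      refine le_trans ?_ hlamδ
      gcongr
    have hd := hdec τ hτT fun s hs => sub_nonneg.1 (hord s hs)
    rw [real_inner_smul_left] at hd
    have hnorm : ‖c a • gaugeGrad (runSup d w a) (w a)‖ ≤ c a * (4 * runSup d w a) := by
      rw [norm_smul, Real.norm_of_nonneg (hc0 a).le]
      have := hc0 a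
      have := norm_gaugeGrad_le (hwn a haT)
      gcongr
    have hgrow : runSup d w τ ≤ max (runSup d w a) (‖w a‖ + 2 * K * (τ - a)) := by
      refine runSup_le ((runSup_nonneg _ _).trans (le_max_left _ _)) fun s hs => ?_
      rcases le_total s a with h | h
      · exact (norm_le_runSup hwc ⟨hs.1, h⟩ haT.2).trans (le_max_left _ _)
      · refine le_trans ?_ (le_max_right _ _)
        have h₁ := hwK s ⟨h, hs.2.trans hτT.2⟩
        have h₂ := norm_add_le (w a) (w s - w a)
        rw [add_sub_cancel] at h₂
        have h₃ : 2 * K * (s - a) ≤ 2 * K * (τ - a) := by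
          have := hs.2
          gcongr
        linarith
    have hmono := runSup_mono hwc hτ.1 hτT.2
    refine energy_estimate hm hlam hδ hδ' (hc0 τ) (hc0 a) ?_ ?_ ?_ hmono (runSup_nonneg _ _)
      hnorm (hB.trans ?_) (sq_le_gauge _ _)
      (gauge_le_expansion (hwn a haT) (hwn τ ⟨ha0.trans hτ.1, hτT.2⟩) hmono hgrow
        (hwK τ hτT)) hd
    · rw [← hcc]
      have := Real.add_one_le_exp (lam * (τ - a))
      have := hc0 τ
      gcongr
      linarith
    · have h₁ : Real.exp (lam * (τ - a)) ≤ 3 :=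
        (Real.exp_le_exp.2 hle1).trans (Real.exp_one_lt_d9.le.trans (by norm_num))
      have := hc0 τ
      rw [← hcc]
      nlinarith
    · have : Real.exp (-(lam * a)) ≤ 1 := Real.exp_le_one_iff.2 (by
        have := mul_nonneg hlam0 ha0
        linarith)
      exact mul_le_of_le_one_right hκ.le this
    · simp only [hc]
      have := hτT.2
      gcongr
  have hρ : 0 ≤ 22 * κ * (2 * K) ^ 2 * δ₀ + B := by positivity
  have hgap : ∀ τ ∈ Icc a b, 0 < y τ - y' τ := by
    refine pos_of_forall_nonneg_before ((hyc.sub hyc').mono (Icc_subset_Icc_right hb))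
      fun τ hτ hord => ?_
    have h₁ := hest τ hτ hord
    have h₂ : (22 * κ * (2 * K) ^ 2 * δ₀ + B) * (τ - a) ≤
        (22 * κ * (2 * K) ^ 2 * δ₀ + B) * (b - a) := by
      have := hτ.2
      gcongr
    have h₃ : 0 ≤ c τ * gauge (runSup d w τ) (w τ) :=
      mul_nonneg (hc0 τ).le ((sq_nonneg _).trans (sq_le_gauge _ _))
    linarith
  exact ⟨x, hx, x', hx', y b, y' b, hyu b ⟨hab.le, hb⟩, hyv b ⟨hab.le, hb⟩,
    hest b ⟨hab.le, le_rfl⟩ fun s hs => (hgap s ⟨hs.1, hs.2.le⟩).le⟩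

/-- A strict gap between `u` and `v` produces a gap of the terminal value along arbitrarily
close paths. -/
theorem exists_close_paths {h : Path d → ℝ} {u v : ℝ → Path d → ℝ}
    (hH1 : HamCont T d H) (hH4 : HamLipX T d H M) (hH5 : HamMono T d H) (hL : 0 ≤ L)
    (hu : MinimaxSub T d H h L u) (hv : MinimaxSuper T d H h L v)
    (ht₀ : t₀ ∈ Ico 0 T) (hx₀ : x₀ ∈ Cadlag T d) (hgap : v t₀ x₀ < u t₀ x₀)
    {η : ℝ} (hη : 0 < η) :
    ∃ x ∈ XSet T d L t₀ x₀, ∃ x' ∈ XSet T d L t₀ x₀,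
      runSup d (fun s => x s - x' s) T ≤ η ∧ (u t₀ x₀ - v t₀ x₀) / 2 ≤ h x - h x' := by
  have hT : 0 < T - t₀ := sub_pos.2 ht₀.2
  have hm := (hH4 L hL).1
  obtain ⟨R, K, hK0, hRK⟩ := exists_bound_lipschitz_XSet (T := T) ht₀.1 ht₀.2.le hL x₀
  have hK := fun x hx => (hRK x hx).2
  obtain ⟨Cu, hCu⟩ := hu.1.exists_bound ht₀.1 ht₀.2.le hL hx₀
  have hvneg : UscOn T d fun t x => -v t x := fun t ht x hx c hc => by
    obtain ⟨δ, hδ, hδv⟩ := hv.1 t ht x hx (-c) (by linarith)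
    exact ⟨δ, hδ, fun s hs x' hx' hd => by linarith [hδv s hs x' hx' hd]⟩
  obtain ⟨Cv, hCv⟩ := hvneg.exists_bound ht₀.1 ht₀.2.le hL hx₀
  set Y := max (max Cu Cv) 0 with hY
  have hYu : ∀ t ∈ Icc t₀ T, ∀ x ∈ XSet T d L t₀ x₀, u t x ≤ Y := fun t ht x hx =>
    (hCu t ht x hx).trans ((le_max_left _ _).trans (le_max_left _ _))
  have hYv : ∀ t ∈ Icc t₀ T, ∀ x ∈ XSet T d L t₀ x₀, -Y ≤ v t x := fun t ht x hx => by
    have := (hCv t ht x hx).trans ((le_max_right Cu Cv).trans (le_max_left _ 0))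
    linarith
  have hY0 : 0 ≤ Y := le_max_right _ _
  set D := u t₀ x₀ - v t₀ x₀ with hD
  have hD0 : 0 < D := sub_pos.2 hgap
  set lam := 12 * M L + 1 with hlam
  set A := (M L * (1 + Y)) ^ 2 / Real.exp (-(lam * T)) with hA
  have hA0 : 0 ≤ A := by positivity
  obtain ⟨κ, hκ0, hκA, hκη⟩ : ∃ κ > 0, 4 * A * (T - t₀) / D ≤ κ ∧
      2 * Y / (η ^ 2 * Real.exp (-(lam * T))) ≤ κ :=
    ⟨max 1 (max (4 * A * (T - t₀) / D) (2 * Y / (η ^ 2 * Real.exp (-(lam * T))))),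
      lt_max_of_lt_left one_pos, (le_max_left _ _).trans (le_max_right _ _),
      (le_max_right _ _).trans (le_max_right _ _)⟩
  have hB : (M L * (1 + Y)) ^ 2 ≤ A / κ * (κ * Real.exp (-(lam * T))) := by
    rw [hA]
    field_simp
    rfl
  obtain ⟨N, hN0, hN₁, hN₂⟩ : ∃ N : ℕ, 0 < N ∧ lam * (T - t₀) ≤ N ∧
      22 * κ * (2 * K) ^ 2 * (T - t₀) ^ 2 * 5 / D ≤ N := by
    obtain ⟨N, hN⟩ := exists_nat_ge
      (max 1 (max (lam * (T - t₀)) (22 * κ * (2 * K) ^ 2 * (T - t₀) ^ 2 * 5 / D)))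
    refine ⟨N, ?_, (le_max_left _ _).trans ((le_max_right _ _).trans hN),
      (le_max_right _ _).trans ((le_max_right _ _).trans hN)⟩
    exact_mod_cast one_pos.trans_le ((le_max_left _ _).trans hN)
  have hNpos : (0 : ℝ) < N := by exact_mod_cast hN0
  set δ := (T - t₀) / N with hδ
  have hδ0 : 0 < δ := by positivity
  have hNδ : N * δ = T - t₀ := by rw [hδ]; field_simp
  have hlamδ : lam * δ ≤ 1 := by
    rw [hδ, ← mul_div_assoc, div_le_one hNpos]
    exact hN₁
  set ρ := 22 * κ * (2 * K) ^ 2 * δ + A / κ with hρ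
  have hρ0 : 0 ≤ ρ := by positivity
  have hρT : ρ * (T - t₀) < D / 2 := by
    have h₁ : 22 * κ * (2 * K) ^ 2 * δ * (T - t₀) ≤ D / 5 := by
      rw [div_le_iff₀ hD0] at hN₂
      rw [hδ, show 22 * κ * (2 * K) ^ 2 * ((T - t₀) / N) * (T - t₀) =
        22 * κ * (2 * K) ^ 2 * (T - t₀) ^ 2 / N by ring, div_le_iff₀ hNpos]
      linarith
    have h₂ : A / κ * (T - t₀) ≤ D / 4 := by
      rw [div_le_iff₀ hD0] at hκA
      rw [div_mul_eq_mul_div, div_le_iff₀ hκ0]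
      linarith
    rw [hρ]
    linarith
  have hind : ∀ i : ℕ, i ≤ N → ∃ x ∈ XSet T d L t₀ x₀, ∃ x' ∈ XSet T d L t₀ x₀, ∃ y y' : ℝ,
      y ≤ u (t₀ + i * δ) x ∧ v (t₀ + i * δ) x' ≤ y' ∧
        D - ρ * (i * δ) ≤ energy κ lam (t₀ + i * δ) x x' y y' := by
    intro i
    induction i with
    | zero =>
      intro _
      obtain ⟨⟨x, y⟩, ⟨hxc, hxeq, -, g, hg, -, hy⟩, hyu⟩ :=
        hu.2.2 t₀ ht₀ x₀ hx₀ 0 (u t₀ x₀) le_rfl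
      obtain ⟨⟨x', y'⟩, ⟨hxc', hxeq', -, g', hg', -, hy'⟩, hyv⟩ :=
        hv.2.2 t₀ ht₀ x₀ hx₀ 0 (v t₀ x₀) le_rfl
      dsimp only at hxc hxeq hg hy hyu hxc' hxeq' hg' hy' hyv
      have htt : t₀ ∈ Icc t₀ T := ⟨le_rfl, ht₀.2.le⟩
      have h₁ := hyu t₀ htt
      have h₂ := hyv t₀ htt
      rw [hy t₀ htt] at h₁
      rw [hy' t₀ htt] at h₂
      simp only [intervalIntegral.integral_same, add_zero] at h₁ h₂
      refine ⟨x, ⟨hxc, hxeq, g, hg⟩, x', ⟨hxc', hxeq', g', hg'⟩, u t₀ x₀, v t₀ x₀, ?_, ?_, ?_⟩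
      · simpa using h₁
      · simpa using h₂
      · have hz : ∀ s ∈ Icc 0 t₀, x s - x' s = 0 := fun s hs => by
          rw [hxeq s hs, hxeq' s hs, sub_self]
        have hr : runSup d (fun s => x s - x' s) t₀ = 0 :=
          le_antisymm (runSup_le le_rfl fun s hs => by rw [hz s hs, norm_zero])
            (runSup_nonneg _ _)
        simp [energy, hr, hz t₀ ⟨ht₀.1, le_rfl⟩, gauge, hD]
    | succ i ih =>
      intro hi
      obtain ⟨x₁, hx₁, x₂, hx₂, y₁, y₂, hy₁, hy₂, hE⟩ := ih (by omega)
      have hiN : ((i : ℝ) + 1) * δ ≤ T - t₀ := by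
        rw [← hNδ]
        have : (i : ℝ) + 1 ≤ N := by exact_mod_cast hi
        gcongr
      have hi0 : 0 ≤ (i : ℝ) * δ := by positivity
      have hiρ : ρ * ((i + 1) * δ) ≤ ρ * (T - t₀) := by gcongr
      have hstep : t₀ + ((i + 1 : ℕ) : ℝ) * δ - (t₀ + i * δ) = δ := by
        push_cast
        ring
      obtain ⟨x, hx, x', hx', y, y', hy, hy', hE'⟩ :=
        exists_energy_step hH1 hH4 hH5 hL hu hv ht₀ hx₀ hYu hYv hK hK0 hκ0 hlam hlamδ
          (B := A / κ) (by positivity) hB (a := t₀ + i * δ) (b := t₀ + ((i + 1 : ℕ) : ℝ) * δ)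
          (by linarith) (by linarith) (by push_cast; linarith) hstep.le hx₁ hx₂ hy₁ hy₂
          (by rw [hstep, ← hρ]; linarith)
      refine ⟨x, hx, x', hx', y, y', hy, hy', ?_⟩
      rw [hstep, ← hρ] at hE'
      refine le_trans ?_ hE'
      push_cast
      linarith
  obtain ⟨x, hx, x', hx', y, y', hy, hy', hE⟩ := hind N le_rfl
  rw [hNδ, add_sub_cancel] at hy hy' hE
  have hTT : T ∈ Icc t₀ T := ⟨ht₀.2.le, le_rfl⟩
  set n := runSup d (fun s => x s - x' s) T with hn
  have hn0 : 0 ≤ n := runSup_nonneg _ _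
  have hc : 0 < κ * Real.exp (-(lam * T)) := by positivity
  have hE₁ : D / 2 + κ * Real.exp (-(lam * T)) * n ^ 2 ≤ y - y' := by
    have := mul_le_mul_of_nonneg_left (sq_le_gauge n (x T - x' T)) hc.le
    simp only [energy, ← hn] at hE
    linarith
  refine ⟨x, hx, x', hx', ?_, ?_⟩
  · have h₁ : κ * Real.exp (-(lam * T)) * n ^ 2 ≤ 2 * Y := by
      linarith [hYu T hTT x hx, hYv T hTT x' hx']
    rw [div_le_iff₀ (by positivity)] at hκη
    have h₂ : κ * Real.exp (-(lam * T)) * n ^ 2 ≤ κ * Real.exp (-(lam * T)) * η ^ 2 := by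
      linarith
    exact le_of_sq_le_sq (le_of_mul_le_mul_left h₂ hc) hη.le
  · have h₁ := hu.2.1 x hx.1
    have h₂ := hv.2.1 x' hx'.1
    have h₃ := mul_nonneg hc.le (sq_nonneg n)
    linarith

theorem comparison_of_lt_terminal {h : Path d → ℝ} {u v : ℝ → Path d → ℝ}
    (hH1 : HamCont T d H) (hH4 : HamLipX T d H M) (hH5 : HamMono T d H) (hh : TermCont T d h)
    (hL : 0 ≤ L) (hu : MinimaxSub T d H h L u) (hv : MinimaxSuper T d H h L v)
    (ht₀ : t₀ ∈ Ico 0 T) (hx₀ : x₀ ∈ Cadlag T d) : u t₀ x₀ ≤ v t₀ x₀ := by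
  by_contra! hgap
  obtain ⟨R, K, hK0, hRK⟩ := exists_bound_lipschitz_XSet (T := T) ht₀.1 ht₀.2.le hL x₀
  choose X hX X' hX' hclose hdiff using fun n : ℕ =>
    exists_close_paths hH1 hH4 hH5 hL hu hv ht₀ hx₀ hgap (Nat.one_div_pos_of_nat (n := n))
  obtain ⟨x, hx, -, φ, hφ, hunif⟩ := exists_subseq_uniform_limit ht₀.1 ht₀.2.le hK0 hx₀ X
    (fun n => (hX n).2.1) (fun n => (hRK _ (hX n)).1) (fun n => (hRK _ (hX n)).2)
  obtain ⟨δ, hδ, hδh⟩ := hh x hx ((u t₀ x₀ - v t₀ x₀) / 4) (by linarith)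
  have hlim := (tendsto_one_div_add_atTop_nhds_zero_nat (𝕜 := ℝ)).comp hφ.tendsto_atTop
  obtain ⟨n, h₁, h₂⟩ := ((hunif (δ / 4) (by positivity)).and
    (hlim.eventually (ge_mem_nhds (show 0 < δ / 4 by positivity)))).exists
  have h₃ : supDist T d x (X (φ n)) < δ :=
    (runSup_le (by positivity) h₁).trans_lt (by linarith)
  have h₄ : supDist T d x (X' (φ n)) < δ := by
    refine (runSup_le (x := fun s => x s - X' (φ n) s) (c := δ / 2) (by positivity)
      fun s hs => ?_).trans_lt (by linarith)
    have e₁ := h₁ s hs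
    have e₂ := (norm_le_runSup (sub_mem_cadlag (hX (φ n)).1 (hX' (φ n)).1) hs le_rfl).trans
      ((hclose (φ n)).trans h₂)
    have e₃ := norm_add_le (x s - X (φ n) s) (X (φ n) s - X' (φ n) s)
    rw [sub_add_sub_cancel] at e₃
    linarith
  have h₅ := abs_lt.1 (hδh _ (hX (φ n)).1 h₃)
  have h₆ := abs_lt.1 (hδh _ (hX' (φ n)).1 h₄)
  linarith [hdiff (φ n), h₅.2, h₆.1]

end Comparison

/-- Comparison principle: a minimax `L`-subsolution lies below any
minimax `L`-supersolution of (TVP). -/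
theorem minimax_comparison (T : ℝ) (hT : 0 < T) (d : ℕ) (hd : 1 ≤ d)
    (H : Ham d) (LH CH : ℝ) (M : ℝ → ℝ)
    (hH1 : HamCont T d H) (hH2 : HamMeas d H) (hH3 : HamLipZ T d H LH)
    (hH4 : HamLipX T d H M) (hH5 : HamMono T d H) (hH6 : HamBound T d H CH)
    (h : Path d → ℝ) (hh : TermCont T d h)
    (L : ℝ) (hL : 0 ≤ L) (u v : ℝ → Path d → ℝ)
    (hu : MinimaxSub T d H h L u) (hv : MinimaxSuper T d H h L v) :
    ∀ t ∈ Icc (0 : ℝ) T, ∀ x ∈ Cadlag T d, u t x ≤ v t x := by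
  intro t ht x hx
  rcases ht.2.eq_or_lt with rfl | hlt
  · exact (hu.2.1 x hx).trans (hv.2.1 x hx)
  · exact comparison_of_lt_terminal hH1 hH4 hH5 hh hL hu hv ⟨ht.1, hlt⟩ hx

end PHJ
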